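/- Let d ≥ 1, n ≥ d+1, let F be a family of (d+1)-element subsets of {1,…,n}, and let p : Fin n → (Fin d → ℝ) be a configuration. Say that (F, p) is locally d-volume rigid if there is an open neighbourhood U of p in the space of configurations such that every q ∈ U with vol_σ(q) = vol_σ(p) for all σ ∈ F satisfies vol_τ(q) = vol_τ(p) for all (d+1)-element subsets τ of {1,…,n}. (a) If the span of the gradients { ∇vol_σ(p) : σ ∈ F } has dimension d·n − (d²+d−1), then (F, p) is locally d-volume rigid. (b) Conversely, if p is generic and (F, p) is locally d-volume rigid, then the span of { ∇vol_σ(p) : σ ∈ F } has dimension d·n − (d²+d−1). -/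

import Mathlib

/-- The signed `d`-volume of the `(d+1)`-element simplex `σ ⊆ Fin n` at the configuration
`p : Fin n → Fin d → ℝ`.  Junk value `0` if `σ` does not have `d+1` elements. -/
noncomputable def vol {n : ℕ} (d : ℕ) (σ : Finset (Fin n)) (p : Fin n → Fin d → ℝ) : ℝ :=
  if h : σ.card = d + 1 then
    Matrix.det
      ((Matrix.of (Fin.cons (fun _ => (1 : ℝ)) fun i j => p (σ.orderEmbOfFin h j) i) :
        Matrix (Fin (d + 1)) (Fin (d + 1)) ℝ))
  else 0

/-- A configuration `p : Fin n → Fin d → ℝ` is generic if every nonzero polynomial with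
rational coefficients in the `d·n` coordinate variables is nonzero at the coordinates
of `p`. -/
def IsGeneric {n : ℕ} (d : ℕ) (p : Fin n → Fin d → ℝ) : Prop :=
  ∀ f : MvPolynomial (Fin n × Fin d) ℚ, f ≠ 0 →
    (MvPolynomial.aeval fun v : Fin n × Fin d => p v.1 v.2) f ≠ 0

/-- `(F, p)` is locally `d`-volume rigid: some open neighbourhood `U` of `p` is such that
every `q ∈ U` whose signed volumes agree with those of `p` on every member of `F` has all
its signed `d`-volumes equal to those of `p`. -/
def LocallyRigid {n : ℕ} (d : ℕ) (F : Finset (Finset (Fin n)))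
    (p : Fin n → Fin d → ℝ) : Prop :=
  ∃ U : Set (Fin n → Fin d → ℝ), IsOpen U ∧ p ∈ U ∧
    ∀ q ∈ U, (∀ σ ∈ F, vol d σ q = vol d σ p) →
      ∀ τ : Finset (Fin n), τ.card = d + 1 → vol d τ q = vol d τ p


section analysis
open Filter Topology

lemma surj_of_li {E : Type*} [NormedAddCommGroup E] [NormedSpace ℝ E]
    {ι : Type*} [Fintype ι] (f : ι → E →L[ℝ] ℝ) (hf : LinearIndependent ℝ f) :
    Function.Surjective (ContinuousLinearMap.pi f) := by
  classical
  by_contra hs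
  have hlt : (ContinuousLinearMap.pi f).range < ⊤ := by
    rw [lt_top_iff_ne_top]
    intro h
    exact hs (LinearMap.range_eq_top.1 h)
  obtain ⟨Λ, h0, hΛ⟩ := Submodule.exists_le_ker_of_lt_top _ hlt
  rw [Fintype.linearIndependent_iff] at hf
  apply h0
  have hz : ∑ i, (Λ (Pi.single i 1)) • f i = 0 := by
    ext x
    have h1 : Λ (ContinuousLinearMap.pi f x) = 0 := hΛ ⟨x, rfl⟩
    rw [LinearMap.pi_apply_eq_sum_univ] at h1
    simp only [smul_eq_mul] at h1
    simp only [sum_apply, smul_apply, smul_eq_mul,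
      zero_apply]
    rw [← h1]
    refine Finset.sum_congr rfl fun i _ => ?_
    rw [mul_comm]
    congr 2
    ext j
    simp [Pi.single_apply, eq_comm]
  have := hf _ hz
  apply LinearMap.pi_ext'
  intro i
  ext
  simpa using this i

lemma fun_dep {E : Type*} [NormedAddCommGroup E] [NormedSpace ℝ E] [FiniteDimensional ℝ E]
    {ι : Type*} [Fintype ι] (g : ι → E → ℝ) (hg : ∀ i, ContDiff ℝ 1 (g i))
    (h : E → ℝ) (hh : ContDiff ℝ 1 h) (p : E)
    (hli : LinearIndependent ℝ (fun i => fderiv ℝ (g i) p))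
    (hdep : ∀ᶠ q in 𝓝 p, fderiv ℝ h q ∈ Submodule.span ℝ (Set.range fun i => fderiv ℝ (g i) q)) :
    ∀ᶠ q in 𝓝 p, (∀ i, g i q = g i p) → h q = h p := by
  have : CompleteSpace E := FiniteDimensional.complete ℝ E
  set G' : E →L[ℝ] (ι → ℝ) := ContinuousLinearMap.pi (fun i => fderiv ℝ (g i) p) with hG'
  have hsurj := surj_of_li _ hli
  obtain ⟨S₀, hS₀⟩ := LinearMap.exists_rightInverse_of_surjective (G' : E →ₗ[ℝ] (ι → ℝ))
    (LinearMap.range_eq_top.2 hsurj)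
  let S : (ι → ℝ) →L[ℝ] E := LinearMap.toContinuousLinearMap S₀
  have hS : ∀ v, G' (S v) = v := fun v => LinearMap.congr_fun hS₀ v
  let G : E → (ι → ℝ) := fun q i => g i q
  have hGc : ContDiff ℝ 1 G := contDiff_pi.2 hg
  have hGd : HasFDerivAt G G' p := by
    rw [hasFDerivAt_pi]
    intro i
    exact ((hg i).differentiable (by norm_num) p).hasFDerivAt
  let Φ : E → E := fun q => S (G q) + (q - S (G' q))
  have hΦc : ContDiff ℝ 1 Φ := by
    have h1 : ContDiff ℝ 1 (fun q => S (G q)) := S.contDiff.comp hGc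
    have h2 : ContDiff ℝ 1 (fun q => S (G' q)) := S.contDiff.comp G'.contDiff
    exact h1.add (contDiff_id.sub h2)
  have hGΦ : ∀ q, G' (Φ q) = G q := by
    intro q
    simp only [Φ, map_add, map_sub, hS]
    simp
  have hΦd : HasFDerivAt Φ ((ContinuousLinearEquiv.refl ℝ E : E ≃L[ℝ] E) : E →L[ℝ] E) p := by
    have h1 : HasFDerivAt (fun q => S (G q)) (S.comp G') p := S.hasFDerivAt.comp p hGd
    have h2 : HasFDerivAt (fun q => S (G' q)) (S.comp G') p := (S.comp G').hasFDerivAt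
    have h3 := h1.add ((hasFDerivAt_id p).sub h2)
    refine h3.congr_fderiv ?_
    ext x
    simp
  have hst := (hΦc.contDiffAt (x := p)).hasStrictFDerivAt' hΦd (by norm_num)
  let Ψ : E → E := (hΦc.contDiffAt (x := p)).localInverse hΦd (by norm_num)
  have hΨc : ContDiffAt ℝ 1 Ψ (Φ p) := (hΦc.contDiffAt (x := p)).to_localInverse hΦd (by norm_num)
  have hΨp : Ψ (Φ p) = p := (hΦc.contDiffAt (x := p)).localInverse_apply_image hΦd (by norm_num)
  have hr : ∀ᶠ y in 𝓝 (Φ p), Φ (Ψ y) = y := hst.eventually_right_inverse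
  have hl : ∀ᶠ q in 𝓝 p, Ψ (Φ q) = q := hst.eventually_left_inverse
  have hcd : ∀ᶠ y in 𝓝 (Φ p), ContDiffAt ℝ 1 Ψ y := hΨc.eventually (by norm_num)
  have hdep' : ∀ᶠ y in 𝓝 (Φ p), fderiv ℝ h (Ψ y) ∈
      Submodule.span ℝ (Set.range fun i => fderiv ℝ (g i) (Ψ y)) := by
    have ht : Tendsto Ψ (𝓝 (Φ p)) (𝓝 p) := by
      have := hΨc.continuousAt.tendsto
      rwa [hΨp] at this
    exact ht.eventually hdep
  obtain ⟨ε, hε, hball⟩ := Metric.eventually_nhds_iff_ball.1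
    ((hr.eventually_nhds.and hcd).and hdep')
  have hΦb : ∀ᶠ q in 𝓝 p, Φ q ∈ Metric.ball (Φ p) ε :=
    hΦc.continuous.continuousAt.eventually (Metric.ball_mem_nhds _ hε)
  filter_upwards [hl, hΦb] with q hq hqb hgq
  have hGq : G q = G p := funext hgq
  -- key fact: the derivative of the composite kills the kernel
  have key : ∀ y ∈ Metric.ball (Φ p) ε, ∀ k, G' k = 0 → fderiv ℝ (fun y => h (Ψ y)) y k = 0 := by
    intro y hy k hk
    obtain ⟨⟨hy1, hy2⟩, hy3⟩ := hball y hy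
    have hΨd : DifferentiableAt ℝ Ψ y := hy2.differentiableAt (by norm_num)
    have hgk : ∀ i, fderiv ℝ (g i) (Ψ y) (fderiv ℝ Ψ y k) = 0 := by
      intro i
      have e1 : (fun z => g i (Ψ z)) =ᶠ[𝓝 y] fun z => G' z i := by
        filter_upwards [hy1] with z hz
        conv_rhs => rw [← hz, hGΦ]
      have d1 : HasFDerivAt (fun z => g i (Ψ z)) ((fderiv ℝ (g i) (Ψ y)).comp (fderiv ℝ Ψ y)) y :=
        (((hg i).differentiable (by norm_num) _).hasFDerivAt).comp y hΨd.hasFDerivAt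
      have d2 : HasFDerivAt (fun z => G' z i) ((ContinuousLinearMap.proj i).comp G') y :=
        ((ContinuousLinearMap.proj i).comp G').hasFDerivAt
      have := (d1.congr_of_eventuallyEq e1.symm).unique d2
      have := congrArg (fun L => L k) this
      simpa [hk] using this
    have d3 : HasFDerivAt (fun z => h (Ψ z)) ((fderiv ℝ h (Ψ y)).comp (fderiv ℝ Ψ y)) y :=
      ((hh.differentiable (by norm_num) _).hasFDerivAt).comp y hΨd.hasFDerivAt
    rw [d3.fderiv, ContinuousLinearMap.comp_apply]
    generalize fderiv ℝ h (Ψ y) = L at hy3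
    induction hy3 using Submodule.span_induction with
    | mem x hx => obtain ⟨i, rfl⟩ := hx; exact hgk i
    | zero => simp
    | add x y _ _ hx hy => simp [hx, hy]
    | smul a x _ hx => simp [hx]
  set k := Φ q - Φ p with hkdef
  have hk : G' k = 0 := by rw [hkdef, map_sub, hGΦ, hGΦ, hGq, sub_self]
  have hmem : ∀ t ∈ Set.Icc (0:ℝ) 1, Φ p + t • k ∈ Metric.ball (Φ p) ε := by
    intro t ht
    have := (convex_ball (Φ p) ε).add_smul_sub_mem (Metric.mem_ball_self hε) hqb ht
    simpa [hkdef] using this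
  have hder : ∀ t ∈ Set.Icc (0:ℝ) 1, HasDerivAt (fun t : ℝ => h (Ψ (Φ p + t • k))) 0 t := by
    intro t ht
    have hb := hmem t ht
    obtain ⟨⟨hy1, hy2⟩, hy3⟩ := hball _ hb
    have hd : DifferentiableAt ℝ (fun y => h (Ψ y)) (Φ p + t • k) :=
      (hh.differentiable (by norm_num) _).comp _ (hy2.differentiableAt (by norm_num))
    have hline : HasDerivAt (fun t : ℝ => Φ p + t • k) k t := by
      simpa using ((hasDerivAt_id t).smul_const k).const_add (Φ p)
    have := hd.hasFDerivAt.comp_hasDerivAt t hline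
    rw [key _ hb k hk] at this
    exact this
  have hconst := constant_of_has_deriv_right_zero
    (f := fun t : ℝ => h (Ψ (Φ p + t • k))) (a := 0) (b := 1)
    (fun t ht => (hder t ht).continuousAt.continuousWithinAt)
    (fun t ht => (hder t ⟨ht.1, ht.2.le⟩).hasDerivWithinAt) 1 (by simp)
  simp only [one_smul, zero_smul, add_zero] at hconst
  rw [hΨp, hkdef, add_sub_cancel, hq] at hconst
  exact hconst

lemma mem_span_of_const {E : Type*} [NormedAddCommGroup E] [NormedSpace ℝ E] [CompleteSpace E]
    {ι : Type*} [Fintype ι] (g : ι → E → ℝ) (hg : ∀ i, ContDiff ℝ 1 (g i))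
    (h : E → ℝ) (hh : ContDiff ℝ 1 h) (p : E)
    (hli : LinearIndependent ℝ (fun i => fderiv ℝ (g i) p))
    (hc : ∀ᶠ q in 𝓝 p, (∀ i, g i q = g i p) → h q = h p) :
    fderiv ℝ h p ∈ Submodule.span ℝ (Set.range fun i => fderiv ℝ (g i) p) := by
  by_contra hn
  have hext : IsLocalExtrOn h {x | ∀ i, g i x = g i p} p := by
    left
    have := hc.filter_mono (nhdsWithin_le_nhds (s := {x | ∀ i, g i x = g i p}))
    filter_upwards [this, self_mem_nhdsWithin] with q hq hq2
    exact (hq hq2).ge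
  refine hext.linear_dependent_of_hasStrictFDerivAt
    (fun i => (hg i).contDiffAt.hasStrictFDerivAt (by norm_num))
    (hh.contDiffAt.hasStrictFDerivAt (by norm_num)) ?_
  rw [linearIndependent_option]
  exact ⟨hli, hn⟩

end analysis

section volumes
open Filter Topology

/-- homogeneous matrix of the points `q (f j)`. -/
def hMat {R : Type*} [One R] {n d : ℕ} (f : Fin (d + 1) → Fin n) (q : Fin n → Fin d → R) :
    Matrix (Fin (d + 1)) (Fin (d + 1)) R :=
  Matrix.of (Fin.cons (fun _ => (1 : R)) fun i j => q (f j) i)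

lemma hMat_zero {R : Type*} [One R] {n d : ℕ} (f : Fin (d + 1) → Fin n) (q : Fin n → Fin d → R)
    (j) : hMat f q 0 j = 1 := rfl

lemma hMat_succ {R : Type*} [One R] {n d : ℕ} (f : Fin (d + 1) → Fin n) (q : Fin n → Fin d → R)
    (i j) : hMat f q (Fin.succ i) j = q (f j) i := rfl

lemma vol_eq_det {n d : ℕ} (σ : Finset (Fin n)) (h : σ.card = d + 1) (q : Fin n → Fin d → ℝ) :
    vol d σ q = (hMat (σ.orderEmbOfFin h) q).det := by
  rw [vol, dif_pos h]; rfl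

lemma det_eq_vol {n d : ℕ} (f : Fin (d + 1) → Fin n) :
    ∃ (c : ℝ) (σ : Finset (Fin n)), ∀ q : Fin n → Fin d → ℝ, (hMat f q).det = c * vol d σ q := by
  classical
  by_cases hf : Function.Injective f
  · have hc : (Finset.univ.image f).card = d + 1 := by
      rw [Finset.card_image_of_injective _ hf]; simp
    have hex : ∀ j, ∃ k, (Finset.univ.image f).orderEmbOfFin hc k = f j := by
      intro j
      have : f j ∈ Set.range ((Finset.univ.image f).orderEmbOfFin hc) := by
        rw [Finset.range_orderEmbOfFin]; simp
      exact this
    choose π hπ using hex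
    have hinj : Function.Injective π := by
      intro a b hab
      apply hf
      rw [← hπ, ← hπ, hab]
    let e : Equiv.Perm (Fin (d + 1)) := Equiv.ofBijective π (Finite.injective_iff_bijective.1 hinj)
    refine ⟨((Equiv.Perm.sign e : ℤ) : ℝ), Finset.univ.image f, fun q => ?_⟩
    rw [vol_eq_det _ hc, ← Matrix.det_permute']
    congr 1
    ext i j
    refine Fin.cases ?_ (fun i => ?_) i
    · simp [hMat_zero]
    · simp only [Matrix.submatrix_apply, id, hMat_succ]
      rw [← hπ j]; rfl
  · refine ⟨0, ∅, fun q => ?_⟩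
    rw [Function.not_injective_iff] at hf
    obtain ⟨a, b, hab, hne⟩ := hf
    rw [zero_mul]
    apply Matrix.det_zero_of_column_eq hne
    intro i
    refine Fin.cases ?_ (fun i => ?_) i
    · simp [hMat_zero]
    · simp [hMat_succ, hab]

/-- rational polynomial representing the volume -/
noncomputable def volP {n : ℕ} (d : ℕ) (σ : Finset (Fin n)) : MvPolynomial (Fin n × Fin d) ℚ :=
  if h : σ.card = d + 1 then
    (hMat (σ.orderEmbOfFin h) (fun i a => (MvPolynomial.X (i, a) : MvPolynomial (Fin n × Fin d) ℚ))).det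
  else 0

/-- evaluation of a rational polynomial at a configuration -/
noncomputable def evP {n d : ℕ} (P : MvPolynomial (Fin n × Fin d) ℚ) (q : Fin n → Fin d → ℝ) : ℝ :=
  (MvPolynomial.aeval fun v : Fin n × Fin d => q v.1 v.2) P

lemma evP_volP {n d : ℕ} (σ : Finset (Fin n)) : evP (volP d σ) = vol d σ := by
  funext q
  by_cases h : σ.card = d + 1
  · rw [vol_eq_det _ h, volP, dif_pos h, evP, AlgHom.map_det]
    congr 1
    ext i j
    refine Fin.cases ?_ (fun i => ?_) i
    · simp [hMat_zero]
    · simp [hMat_succ]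
  · simp [evP, volP, vol, h]

/-- standard basis of configuration space -/
def eB {n d : ℕ} (k : Fin n × Fin d) : Fin n → Fin d → ℝ := Pi.single k.1 (Pi.single k.2 1)

lemma evP_diff {n d : ℕ} (P : MvPolynomial (Fin n × Fin d) ℚ) :
    ContDiff ℝ 2 (evP P) ∧ ∀ q k, fderiv ℝ (evP P) q (eB k) = evP (MvPolynomial.pderiv k P) q := by
  classical
  induction P using MvPolynomial.induction_on with
  | C a =>
    have : evP (n := n) (d := d) (MvPolynomial.C a) = fun _ => (a : ℝ) := by
      funext q; simp [evP]
    rw [this]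
    refine ⟨contDiff_const, fun q k => ?_⟩
    simp [evP]
  | add P Q hP hQ =>
    have : evP (P + Q) = evP P + evP Q := by funext q; simp [evP]
    rw [this]
    refine ⟨hP.1.add hQ.1, fun q k => ?_⟩
    rw [fderiv_add (hP.1.differentiable (by norm_num) q) (hQ.1.differentiable (by norm_num) q)]
    simp [hP.2, hQ.2, evP]
  | mul_X P v hP =>
    let L : (Fin n → Fin d → ℝ) →L[ℝ] ℝ :=
      (ContinuousLinearMap.proj (R := ℝ) (φ := fun _ : Fin d => ℝ) v.2).comp
        (ContinuousLinearMap.proj (R := ℝ) (φ := fun _ : Fin n => Fin d → ℝ) v.1)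
    have : evP (P * MvPolynomial.X v) = fun q => evP P q * L q := by
      funext q; simp [evP, L]
    rw [this]
    refine ⟨hP.1.mul L.contDiff, fun q k => ?_⟩
    have hd := ((hP.1.differentiable (by norm_num) q).hasFDerivAt).mul (L.hasFDerivAt (x := q))
    have e := hd.fderiv
    simp only [Pi.mul_def] at e
    rw [e]
    have hL : L (eB k) = if k = v then 1 else 0 := by
      simp only [L, eB, ContinuousLinearMap.comp_apply, ContinuousLinearMap.proj_apply]
      obtain ⟨a, b⟩ := k
      obtain ⟨a', b'⟩ := v
      by_cases h1 : a = a'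
      · subst h1
        simp [Pi.single_apply, eq_comm]
      · simp [h1, Ne.symm h1]
    have hX : (MvPolynomial.pderiv k) (MvPolynomial.X v : MvPolynomial (Fin n × Fin d) ℚ)
        = if k = v then 1 else 0 := by
      rw [MvPolynomial.pderiv_X]; simp [Pi.single_apply, eq_comm]
    have hq : L q = q v.1 v.2 := rfl
    simp only [add_apply, smul_apply, smul_eq_mul, hP.2, hL, Derivation.leibniz, hX, hq]
    by_cases h : k = v <;> simp [evP, h]

lemma vol_contDiff {n d : ℕ} (σ : Finset (Fin n)) : ContDiff ℝ 2 (vol (n := n) d σ) := by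
  rw [← evP_volP]; exact (evP_diff _).1

lemma vol_diff {n d : ℕ} (σ : Finset (Fin n)) : Differentiable ℝ (vol (n := n) d σ) :=
  (vol_contDiff σ).differentiable (by norm_num)

lemma vol_fderiv_continuous {n d : ℕ} (σ : Finset (Fin n)) :
    Continuous (fderiv ℝ (vol (n := n) d σ)) :=
  (vol_contDiff σ).continuous_fderiv (by norm_num)

lemma sum_eB {n d : ℕ} (v : Fin n → Fin d → ℝ) : v = ∑ k, v k.1 k.2 • eB k := by
  funext i a
  simp only [eB, Finset.sum_apply, Pi.smul_apply, smul_eq_mul]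
  rw [Fintype.sum_prod_type]
  simp [Pi.single_apply, apply_ite, ite_apply, Finset.sum_ite_eq]

/-- genericity transfers independence -/
lemma li_generic {n d : ℕ} (p : Fin n → Fin d → ℝ) (hp : IsGeneric d p)
    (B : Set (Finset (Fin n))) (q : Fin n → Fin d → ℝ)
    (hq : LinearIndepOn ℝ (fun σ => fderiv ℝ (vol d σ) q) B) :
    LinearIndepOn ℝ (fun σ => fderiv ℝ (vol d σ) p) B := by
  classical
  have : Fintype B := Fintype.ofFinite B
  let JP : Matrix B (Fin n × Fin d) (MvPolynomial (Fin n × Fin d) ℚ) :=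
    Matrix.of fun σ k => MvPolynomial.pderiv k (volP d σ.1)
  let J : (Fin n → Fin d → ℝ) → Matrix B (Fin n × Fin d) ℝ :=
    fun q => Matrix.of fun σ k => fderiv ℝ (vol d σ.1) q (eB k)
  let g := (JP * JP.transpose).det
  have hJ : ∀ q, JP.map (MvPolynomial.aeval fun v : Fin n × Fin d => q v.1 v.2) = J q := by
    intro q
    ext σ k
    simp only [JP, J, Matrix.map_apply, Matrix.of_apply]
    rw [← evP_volP, (evP_diff _).2]; rfl
  have hg : ∀ q, evP g q = (J q * (J q).transpose).det := by
    intro q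
    simp only [evP, g]
    rw [AlgHom.map_det, ← hJ]
    congr 1
    rw [AlgHom.mapMatrix_apply, Matrix.map_mul, Matrix.transpose_map]
  -- the evaluation map
  let T : ((Fin n → Fin d → ℝ) →L[ℝ] ℝ) →ₗ[ℝ] (Fin n × Fin d → ℝ) :=
    { toFun := fun L k => L (eB k)
      map_add' := fun _ _ => rfl
      map_smul' := fun _ _ => rfl }
  have hT : LinearMap.ker T = ⊥ := by
    rw [LinearMap.ker_eq_bot']
    intro L hL
    ext v
    rw [sum_eB v, map_sum]
    simp only [map_smul]
    have : ∀ k, L (eB k) = 0 := fun k => congrFun hL k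
    simp [this]
  have hrow : ∀ q, LinearIndepOn ℝ (fun σ => fderiv ℝ (vol d σ) q) B ↔
      LinearIndependent ℝ (J q).row := by
    intro q
    have := LinearMap.linearIndependent_iff (v := fun σ : B => fderiv ℝ (vol d σ.1) q) T hT
    exact this.symm
  rw [hrow] at hq ⊢
  have hne : g ≠ 0 := by
    intro h0
    have h1 : evP g q = 0 := by rw [h0]; simp [evP]
    rw [hg] at h1
    have h2 := hq.rank_matrix
    rw [← Matrix.rank_self_mul_transpose] at h2
    have h3 : LinearIndependent ℝ (J q * (J q).transpose).row := by
      rw [linearIndependent_iff_card_eq_finrank_span, ← h2, Matrix.rank_eq_finrank_span_row]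
      rfl
    rw [Matrix.linearIndependent_rows_iff_isUnit, Matrix.isUnit_iff_isUnit_det, h1] at h3
    exact not_isUnit_zero h3
  have h1 : evP g p ≠ 0 := hp g hne
  rw [hg] at h1
  rw [← Matrix.vecMul_injective_iff]
  have h2 : Function.Injective (fun w => Matrix.vecMul w (J p * (J p).transpose)) := by
    rw [Matrix.vecMul_injective_iff, Matrix.linearIndependent_rows_iff_isUnit,
      Matrix.isUnit_iff_isUnit_det]
    exact isUnit_iff_ne_zero.2 h1
  intro a b hab
  apply h2
  simp only [← Matrix.vecMul_vecMul]
  simp only at hab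
  rw [hab]

end volumes

section ranks
open Filter Topology

/-- common kernel of all gradients -/
noncomputable def kerAll {n : ℕ} (d : ℕ) (q : Fin n → Fin d → ℝ) :
    Submodule ℝ (Fin n → Fin d → ℝ) :=
  ⨅ σ : Finset (Fin n), LinearMap.ker (fderiv ℝ (vol d σ) q).toLinearMap

lemma mem_kerAll {n d : ℕ} (q v : Fin n → Fin d → ℝ) :
    v ∈ kerAll d q ↔ ∀ σ : Finset (Fin n), fderiv ℝ (vol d σ) q v = 0 := by
  simp [kerAll, Submodule.mem_iInf]

/-- span of all gradients -/
noncomputable def spanAll {n : ℕ} (d : ℕ) (q : Fin n → Fin d → ℝ) :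
    Submodule ℝ ((Fin n → Fin d → ℝ) →L[ℝ] ℝ) :=
  Submodule.span ℝ (Set.range fun σ : Finset (Fin n) => fderiv ℝ (vol d σ) q)

lemma finrank_span_add_ker {n d : ℕ} (q : Fin n → Fin d → ℝ) :
    Module.finrank ℝ (spanAll d q) + Module.finrank ℝ (kerAll d q) = d * n := by
  let C : ((Fin n → Fin d → ℝ) →L[ℝ] ℝ) →ₗ[ℝ] Module.Dual ℝ (Fin n → Fin d → ℝ) :=
    ContinuousLinearMap.coeLM ℝ
  have hC : Function.Injective C := ContinuousLinearMap.coe_injective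
  have h1 : Module.finrank ℝ ((spanAll d q).map C) = Module.finrank ℝ (spanAll d q) :=
    (Submodule.equivMapOfInjective C hC (spanAll d q)).finrank_eq.symm
  have h2 : ((spanAll d q).map C).dualCoannihilator = kerAll d q := by
    ext v
    rw [mem_kerAll, Submodule.mem_dualCoannihilator]
    constructor
    · intro h σ
      exact h _ ⟨_, Submodule.subset_span ⟨σ, rfl⟩, rfl⟩
    · rintro h _ ⟨L, hL, rfl⟩
      change L v = 0
      simp only [spanAll] at hL
      induction hL using Submodule.span_induction with
      | mem x hx => obtain ⟨i, rfl⟩ := hx; exact h i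
      | zero => simp
      | add x y _ _ hx hy => simp [hx, hy]
      | smul a x _ hx => simp [hx]
  rw [← h1, ← h2, Subspace.finrank_add_finrank_dualCoannihilator_eq]
  simp [Module.finrank_pi_fintype, mul_comm]

lemma hasDerivAt_vol_line {n d : ℕ} (σ : Finset (Fin n)) (q v : Fin n → Fin d → ℝ) :
    HasDerivAt (fun t : ℝ => vol d σ (q + t • v)) (fderiv ℝ (vol d σ) q v) 0 := by
  have hline : HasDerivAt (fun t : ℝ => q + t • v) v 0 := by
    simpa using ((hasDerivAt_id (0:ℝ)).smul_const v).const_add q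
  have h := (vol_diff (d := d) σ (q + (0:ℝ) • v)).hasFDerivAt.comp_hasDerivAt (0:ℝ) hline
  have e : fderiv ℝ (vol d σ) (q + (0:ℝ) • v) v = fderiv ℝ (vol d σ) q v := by simp
  rw [e] at h
  exact h

/-- infinitesimal affine motion -/
noncomputable def mot {n d : ℕ} (q : Fin n → Fin d → ℝ) :
    Matrix (Fin d) (Fin (d + 1)) ℝ →ₗ[ℝ] (Fin n → Fin d → ℝ) where
  toFun B := fun i => B.mulVec (Fin.cons 1 (q i) : Fin (d + 1) → ℝ)
  map_add' A B := by funext i; simp [Matrix.add_mulVec]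
  map_smul' c B := by funext i; simp [Matrix.smul_mulVec]

lemma hMat_mot {n d : ℕ} (q : Fin n → Fin d → ℝ) (B : Matrix (Fin d) (Fin (d + 1)) ℝ) (t : ℝ)
    (f : Fin (d + 1) → Fin n) :
    hMat f (q + t • mot q B) =
      (1 + t • (Matrix.of (Fin.cons 0 B) : Matrix (Fin (d + 1)) (Fin (d + 1)) ℝ)) * hMat f q := by
  have hcol : ∀ j, (fun k => hMat f q k j) = (Fin.cons 1 (q (f j)) : Fin (d + 1) → ℝ) := by
    intro j; funext k
    refine Fin.cases ?_ (fun k => ?_) k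
    · simp [hMat_zero]
    · simp [hMat_succ]
  ext i j
  rw [Matrix.add_mul, Matrix.one_mul, Matrix.smul_mul, Matrix.add_apply, Matrix.smul_apply,
    Matrix.mul_apply_eq_vecMul]
  refine Fin.cases ?_ (fun i => ?_) i
  · simp only [hMat_zero, Matrix.vecMul, dotProduct, smul_eq_mul]
    have h0 : ∀ k, (Matrix.of (Fin.cons 0 B) : Matrix (Fin (d + 1)) (Fin (d + 1)) ℝ) 0 k = 0 :=
      fun _ => rfl
    simp [h0]
  · simp only [hMat_succ, mot, LinearMap.coe_mk, AddHom.coe_mk, Pi.add_apply, Pi.smul_apply,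
      Matrix.mulVec, Matrix.vecMul, ← hcol]
    rfl

lemma vol_mot {n d : ℕ} (q : Fin n → Fin d → ℝ) (B : Matrix (Fin d) (Fin (d + 1)) ℝ) (t : ℝ)
    (τ : Finset (Fin n)) :
    vol d τ (q + t • mot q B) =
      (1 + t • (Matrix.of (Fin.cons 0 B) : Matrix (Fin (d + 1)) (Fin (d + 1)) ℝ)).det
        * vol d τ q := by
  by_cases h : τ.card = d + 1
  · rw [vol_eq_det _ h, vol_eq_det _ h, hMat_mot, Matrix.det_mul]
  · simp [vol, h]

lemma fderiv_mot {n d : ℕ} (q : Fin n → Fin d → ℝ) (B : Matrix (Fin d) (Fin (d + 1)) ℝ)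
    (σ τ : Finset (Fin n)) :
    vol d σ q * fderiv ℝ (vol d τ) q (mot q B) = vol d τ q * fderiv ℝ (vol d σ) q (mot q B) := by
  have h1 := (hasDerivAt_vol_line τ q (mot q B)).const_mul (vol d σ q)
  have h2 := (hasDerivAt_vol_line σ q (mot q B)).const_mul (vol d τ q)
  have he : (fun t : ℝ => vol d σ q * vol d τ (q + t • mot q B)) =
      fun t : ℝ => vol d τ q * vol d σ (q + t • mot q B) := by
    funext t
    rw [vol_mot, vol_mot]; ring
  rw [he] at h1
  exact h1.unique h2

lemma ker_lower {n d : ℕ} (q : Fin n → Fin d → ℝ) (σ : Finset (Fin n)) (hσ : vol d σ q ≠ 0) :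
    d * (d + 1) ≤ Module.finrank ℝ (kerAll d q) + 1 := by
  have hcard : σ.card = d + 1 := by
    by_contra h
    exact hσ (by simp [vol, h])
  have hinj : Function.Injective (mot q) := by
    rw [← LinearMap.ker_eq_bot, LinearMap.ker_eq_bot']
    intro B hB
    have hdet : IsUnit (hMat (σ.orderEmbOfFin hcard) q).det := by
      rw [← vol_eq_det]; exact isUnit_iff_ne_zero.2 hσ
    have hz : B * hMat (σ.orderEmbOfFin hcard) q = 0 := by
      ext a j
      have := congrFun (congrFun hB (σ.orderEmbOfFin hcard j)) a
      rw [Matrix.zero_apply, ← Pi.zero_apply (M := fun _ => ℝ) a]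
      refine Eq.trans ?_ this
      rw [Matrix.mul_apply]
      simp only [mot, LinearMap.coe_mk, AddHom.coe_mk, Matrix.mulVec, dotProduct]
      refine Finset.sum_congr rfl fun k _ => ?_
      congr 1
      refine Fin.cases ?_ (fun k => ?_) k
      · simp [hMat_zero]
      · simp [hMat_succ]
    have := congrArg (fun M => M * (hMat (σ.orderEmbOfFin hcard) q)⁻¹) hz
    simpa [Matrix.mul_assoc, Matrix.mul_nonsing_inv _ hdet] using this
  let c : Matrix (Fin d) (Fin (d + 1)) ℝ →ₗ[ℝ] ℝ := (fderiv ℝ (vol d σ) q).toLinearMap.comp (mot q)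
  have hle : (LinearMap.ker c).map (mot q) ≤ kerAll d q := by
    rintro _ ⟨B, hB, rfl⟩
    rw [mem_kerAll]
    intro τ
    have hB' : fderiv ℝ (vol d σ) q (mot q B) = 0 := hB
    have := fderiv_mot q B σ τ
    rw [hB', mul_zero] at this
    exact (mul_eq_zero.1 this).resolve_left hσ
  have h1 := Submodule.finrank_mono hle
  rw [← (Submodule.equivMapOfInjective (mot q) hinj (LinearMap.ker c)).finrank_eq] at h1
  have h2 := LinearMap.finrank_range_add_finrank_ker c
  have h3 : Module.finrank ℝ (LinearMap.range c) ≤ 1 := by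
    have := Submodule.finrank_le (LinearMap.range c)
    simpa using this
  rw [Module.finrank_matrix] at h2
  simp at h2
  omega

lemma kerAll_det {n d : ℕ} (q v : Fin n → Fin d → ℝ) (hv : v ∈ kerAll d q)
    (f : Fin (d + 1) → Fin n) :
    HasDerivAt (fun t : ℝ => (hMat f (q + t • v)).det) 0 0 := by
  obtain ⟨c, σ, h⟩ := det_eq_vol (d := d) f
  simp only [h]
  have := (hasDerivAt_vol_line σ q v).const_mul c
  rwa [(mem_kerAll q v).1 hv σ, mul_zero] at this

lemma ker_upper {n d : ℕ} (hd : 1 ≤ d) (p : Fin n → Fin d → ℝ) (σ : Finset (Fin n))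
    (hσ : vol d σ p ≠ 0) :
    Module.finrank ℝ (kerAll d p) + 1 ≤ d * (d + 1) := by
  have hcard : σ.card = d + 1 := by
    by_contra h
    exact hσ (by simp [vol, h])
  set e : Fin (d + 1) → Fin n := ⇑(σ.orderEmbOfFin hcard) with he
  set M := hMat e p with hM
  have hMd : M.det ≠ 0 := by rw [hM, he, ← vol_eq_det]; exact hσ
  -- restriction to σ
  let T : (Fin n → Fin d → ℝ) →ₗ[ℝ] (Fin (d + 1) → Fin d → ℝ) :=
    { toFun := fun v j => v (e j)
      map_add' := fun _ _ => rfl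
      map_smul' := fun _ _ => rfl }
  have hTv : ∀ v, T v = 0 → fderiv ℝ (vol d σ) p v = 0 := by
    intro v hv
    have h1 := hasDerivAt_vol_line σ p v
    have h2 : (fun t : ℝ => vol d σ (p + t • v)) = fun _ => vol d σ p := by
      funext t
      rw [vol_eq_det _ hcard, vol_eq_det _ hcard]
      congr 1
      ext i j
      refine Fin.cases ?_ (fun i => ?_) i
      · simp [hMat_zero]
      · have : v (e j) = 0 := congrFun hv j
        simp only [hMat_succ, Pi.add_apply, Pi.smul_apply]
        rw [← he, this]; simp
    rw [h2] at h1
    exact h1.unique (hasDerivAt_const _ _)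
  -- rigidity of the others
  have hinjK : ∀ v ∈ kerAll d p, T v = 0 → v = 0 := by
    intro v hv hT
    have hTe : ∀ j, v (e j) = 0 := fun j => congrFun hT j
    funext i
    let w : Fin (d + 1) → ℝ := Fin.cons 0 (v i)
    have hcr : M.cramer w = 0 := by
      funext k
      rw [Matrix.cramer_apply]
      have h1 := kerAll_det p v hv (Function.update e k i)
      have h2 : ∀ t : ℝ, (hMat (Function.update e k i) (p + t • v)).det =
          (M.updateCol k (Fin.cons 1 (p i))).det + t * (M.updateCol k w).det := by
        intro t
        rw [← Matrix.det_updateCol_smul, ← Matrix.det_updateCol_add]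
        congr 1
        ext a j
        by_cases hj : j = k
        · subst hj
          refine Fin.cases ?_ (fun a => ?_) a
          · simp [hMat_zero, w]
          · simp [hMat_succ, w]
        · refine Fin.cases ?_ (fun a => ?_) a
          · simp [hMat_zero, hM, hj]
          · simp [hMat_succ, hM, hj, hTe]
      simp only [h2] at h1
      have h3 : HasDerivAt (fun t : ℝ => (M.updateCol k (Fin.cons 1 (p i))).det
          + t * (M.updateCol k w).det) (M.updateCol k w).det 0 := by
        simpa using ((hasDerivAt_id (0:ℝ)).mul_const (M.updateCol k w).det).const_add
          (M.updateCol k (Fin.cons 1 (p i))).det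
      exact h3.unique h1
    have h4 := Matrix.mulVec_cramer M w
    rw [hcr, Matrix.mulVec_zero] at h4
    funext a
    have h5 := congrFun h4 a.succ
    simp [w] at h5
    exact h5.resolve_left hMd
  -- a direction that changes vol σ
  let a0 : Fin d := ⟨0, hd⟩
  let x : Fin n → Fin d → ℝ := fun i => Pi.single a0 (p i a0)
  have hx : fderiv ℝ (vol d σ) p x ≠ 0 := by
    have h1 := hasDerivAt_vol_line σ p x
    have h2 : (fun t : ℝ => vol d σ (p + t • x)) = fun t => (1 + t) * vol d σ p := by
      funext t
      rw [vol_eq_det _ hcard, vol_eq_det _ hcard, ← he, ← hM]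
      conv_rhs => rw [← Matrix.updateRow_eq_self M a0.succ]
      rw [← Matrix.det_updateRow_smul]
      congr 1
      ext i j
      refine Fin.cases ?_ (fun i => ?_) i
      · simp [hMat_zero, hM, Matrix.updateRow_apply, (Fin.succ_ne_zero a0).symm]
      · by_cases hi : i = a0
        · subst hi
          simp [hMat_succ, hM, x]; ring
        · simp [hMat_succ, hM, x, hi, Matrix.updateRow_apply]
    rw [h2] at h1
    have h3 : HasDerivAt (fun t : ℝ => (1 + t) * vol d σ p) (vol d σ p) 0 := by
      simpa using ((hasDerivAt_id (0:ℝ)).const_add 1).mul_const (vol d σ p)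
    rw [h1.unique h3]
    exact hσ
  let Q : (kerAll d p) × ℝ →ₗ[ℝ] (Fin (d + 1) → Fin d → ℝ) :=
    T.comp ((kerAll d p).subtype.coprod (LinearMap.toSpanSingleton ℝ _ x))
  have hQ : Function.Injective Q := by
    rw [← LinearMap.ker_eq_bot, LinearMap.ker_eq_bot']
    rintro ⟨⟨v, hv⟩, c⟩ h
    have h' : T (v + c • x) = 0 := h
    have h1 := hTv _ h'
    rw [map_add, map_smul, (mem_kerAll p v).1 hv σ, zero_add, smul_eq_mul] at h1
    have hc : c = 0 := (mul_eq_zero.1 h1).resolve_right hx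
    subst hc
    have := hinjK v hv (by simpa using h')
    subst this
    rfl
  have := LinearMap.finrank_le_finrank_of_injective hQ
  simp [Module.finrank_pi_fintype] at this
  linarith [mul_comm d (d + 1)]

end ranks

section main
open Filter Topology

/-- basis of the gradients of a family at a configuration, with stability of independence. -/
lemma exists_basis {n d : ℕ} (p : Fin n → Fin d → ℝ) (F : Set (Finset (Fin n))) :
    ∃ B ⊆ F, LinearIndepOn ℝ (fun σ => fderiv ℝ (vol d σ) p) B ∧
      Submodule.span ℝ (Set.range fun σ : B => fderiv ℝ (vol d σ.1) p) =
        Submodule.span ℝ (Set.range fun σ : F => fderiv ℝ (vol d σ.1) p) := by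
  obtain ⟨B, hBF, -, hsp, hli⟩ := exists_linearIndepOn_extension
    (K := ℝ) (v := fun σ => fderiv ℝ (vol d σ) p) (linearIndepOn_empty ℝ _) (Set.empty_subset F)
  refine ⟨B, hBF, hli, le_antisymm ?_ ?_⟩
  · apply Submodule.span_mono
    rintro _ ⟨σ, rfl⟩
    exact ⟨⟨σ.1, hBF σ.2⟩, rfl⟩
  · rw [Submodule.span_le]
    rintro _ ⟨σ, rfl⟩
    have := hsp ⟨σ.1, σ.2, rfl⟩
    rwa [Set.image_eq_range] at this

lemma li_eventually {n d : ℕ} (p : Fin n → Fin d → ℝ) (B : Set (Finset (Fin n)))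
    (h : LinearIndepOn ℝ (fun σ => fderiv ℝ (vol d σ) p) B) :
    ∀ᶠ q in 𝓝 p, LinearIndepOn ℝ (fun σ => fderiv ℝ (vol d σ) q) B := by
  have hc : Continuous fun q => fun σ : B => fderiv ℝ (vol d σ.1) q :=
    continuous_pi fun σ => vol_fderiv_continuous σ.1
  have ho := (isOpen_setOfPred_linearIndependent (𝕜 := ℝ) (ι := B)
    (E := (Fin n → Fin d → ℝ) →L[ℝ] ℝ)).preimage hc
  exact ho.mem_nhds h

lemma span_le_of_vol {n d : ℕ} (q : Fin n → Fin d → ℝ) (σ : Finset (Fin n))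
    (hσ : vol d σ q ≠ 0) :
    Module.finrank ℝ (spanAll d q) ≤ d * n - (d ^ 2 + d - 1) := by
  have h1 := ker_lower q σ hσ
  have h2 := finrank_span_add_ker (d := d) q
  have h3 : d ^ 2 + d = d * (d + 1) := by ring
  omega

lemma finrank_le_spanAll {n d : ℕ} (q : Fin n → Fin d → ℝ) (B : Set (Finset (Fin n))) :
    Submodule.span ℝ (Set.range fun σ : B => fderiv ℝ (vol d σ.1) q) ≤ spanAll d q := by
  apply Submodule.span_mono
  rintro _ ⟨σ, rfl⟩
  exact ⟨σ.1, rfl⟩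

lemma span_le {n d : ℕ} (q : Fin n → Fin d → ℝ) :
    Module.finrank ℝ (spanAll d q) ≤ d * n - (d ^ 2 + d - 1) := by
  classical
  obtain ⟨B, -, hli, hsp⟩ := exists_basis (d := d) q Set.univ
  have : Fintype B := Fintype.ofFinite B
  have hall : spanAll d q =
      Submodule.span ℝ (Set.range fun σ : B => fderiv ℝ (vol d σ.1) q) := by
    rw [hsp]
    refine le_antisymm ?_ (finrank_le_spanAll q _)
    apply Submodule.span_mono
    rintro _ ⟨σ, rfl⟩
    exact ⟨⟨σ, trivial⟩, rfl⟩
  have hrank : Module.finrank ℝ (spanAll d q) = Fintype.card B := by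
    rw [hall]; exact finrank_span_eq_card hli
  rcases B.eq_empty_or_nonempty with hB | ⟨σ, hσ⟩
  · subst hB
    rw [hrank]; simp
  · have hne : fderiv ℝ (vol d σ) q ≠ 0 := hli.ne_zero hσ
    have hfreq : ∃ᶠ q' in 𝓝 q, vol d σ q' ≠ 0 := by
      intro hcon
      apply hne
      have : vol d σ =ᶠ[𝓝 q] fun _ => 0 := by
        filter_upwards [hcon] with x hx
        simpa using hx
      rw [this.fderiv_eq]; simp
    obtain ⟨q', hq1, hq2⟩ := (hfreq.and_eventually (li_eventually q B hli)).exists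
    have h1 := Submodule.finrank_mono (finrank_le_spanAll (d := d) q' B)
    have h2 := finrank_span_eq_card hq2
    have h3 := span_le_of_vol q' σ hq1
    rw [hrank]
    have h2' : Module.finrank ℝ (Submodule.span ℝ
      (Set.range fun σ : B => fderiv ℝ (vol d σ.1) q')) = Fintype.card B := h2
    omega

lemma generic_vol {n d : ℕ} (hn : d + 1 ≤ n) (p : Fin n → Fin d → ℝ) (hp : IsGeneric d p) :
    ∃ σ : Finset (Fin n), vol d σ p ≠ 0 := by
  classical
  let e : Fin (d + 1) → Fin n := Fin.castLE hn
  have he : Function.Injective e := Fin.castLE_injective hn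
  obtain ⟨c, σ, h⟩ := det_eq_vol (d := d) e
  refine ⟨σ, ?_⟩
  rw [← evP_volP]
  apply hp
  intro h0
  have hz : ∀ q, vol d σ q = 0 := by
    intro q; rw [← evP_volP, h0]; simp [evP]
  -- standard simplex
  let q : Fin n → Fin d → ℝ := fun i a => if (i : ℕ) = (a : ℕ) + 1 then 1 else 0
  have h1 := h q
  rw [hz, mul_zero] at h1
  have h2 : (hMat e q).det = 1 := by
    rw [Matrix.det_of_upperTriangular]
    · apply Finset.prod_eq_one
      intro i _
      refine Fin.cases ?_ (fun i => ?_) i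
      · rw [hMat_zero]
      · simp [hMat_succ, q, e]
    · intro i j hij
      refine Fin.cases (fun hij => ?_) (fun i hij => ?_) i hij
      · simp at hij
      · have hij' : j < i.succ := hij
        have : (j : ℕ) < (i : ℕ) + 1 := by simpa [Fin.lt_def] using hij'
        simp [hMat_succ, q, e]
        omega
  rw [h2] at h1
  exact one_ne_zero h1

lemma span_generic {n d : ℕ} (hd : 1 ≤ d) (hn : d + 1 ≤ n) (p : Fin n → Fin d → ℝ)
    (hp : IsGeneric d p) :
    Module.finrank ℝ (spanAll d p) = d * n - (d ^ 2 + d - 1) := by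
  obtain ⟨σ, hσ⟩ := generic_vol hn p hp
  have h0 := span_le (d := d) p
  have h1 := ker_upper hd p σ hσ
  have h2 := finrank_span_add_ker (d := d) p
  have h3 : d ^ 2 + d = d * (d + 1) := by ring
  omega

lemma vol_cd1 {n d : ℕ} (σ : Finset (Fin n)) : ContDiff ℝ 1 (vol (n := n) d σ) :=
  (vol_contDiff σ).of_le (by norm_num)

end main

/-- (a) If the span of the volume gradients `{∇vol_σ(p) : σ ∈ F}` has dimension
`d·n - (d² + d - 1)`, then `(F, p)` is locally `d`-volume rigid; and (b) conversely, if `p`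
is generic and `(F, p)` is locally `d`-volume rigid, then that span has dimension
`d·n - (d² + d - 1)`. -/
theorem rank_of_rigidity_matrix (d n : ℕ) (hd : 1 ≤ d) (hn : d + 1 ≤ n)
    (F : Finset (Finset (Fin n))) (hF : ∀ σ ∈ F, σ.card = d + 1)
    (p : Fin n → Fin d → ℝ) :
    ((Module.finrank ℝ
        ↥(Submodule.span ℝ (Set.range fun σ : F => fderiv ℝ (vol d σ.1) p))
          = d * n - (d ^ 2 + d - 1)) → LocallyRigid d F p)
    ∧ (IsGeneric d p → LocallyRigid d F p →
        Module.finrank ℝ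
          ↥(Submodule.span ℝ (Set.range fun σ : F => fderiv ℝ (vol d σ.1) p))
            = d * n - (d ^ 2 + d - 1)) := by
  classical
  obtain ⟨B, hBF, hli, hsp⟩ := exists_basis (d := d) p (F : Set (Finset (Fin n)))
  have : Fintype B := Fintype.ofFinite B
  have hsp' : Submodule.span ℝ (Set.range fun σ : B => fderiv ℝ (vol d σ.1) p) =
      Submodule.span ℝ (Set.range fun σ : F => fderiv ℝ (vol d σ.1) p) := hsp
  have hBcard : Module.finrank ℝ
      (Submodule.span ℝ (Set.range fun σ : F => fderiv ℝ (vol d σ.1) p)) = Fintype.card B := by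
    rw [← hsp']; exact finrank_span_eq_card hli
  have hev := li_eventually p B hli
  constructor
  · intro hr
    have hall : ∀ᶠ q in nhds p, ∀ τ : Finset (Fin n),
        (∀ σ : B, vol d σ.1 q = vol d σ.1 p) → vol d τ q = vol d τ p := by
      rw [Filter.eventually_all]
      intro τ
      refine fun_dep (fun σ : B => vol d σ.1) (fun σ => vol_cd1 _) (vol d τ) (vol_cd1 _) p hli ?_
      filter_upwards [hev] with q hq
      have h1 : Module.finrank ℝ (Submodule.span ℝ
        (Set.range fun σ : B => fderiv ℝ (vol d σ.1) q)) = Fintype.card B :=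
        finrank_span_eq_card hq
      have h2 := span_le (d := d) q
      have h3 := Submodule.eq_of_le_of_finrank_le (finrank_le_spanAll (d := d) q B) (by omega)
      rw [h3]
      exact Submodule.subset_span ⟨τ, rfl⟩
    obtain ⟨U, hU, hUo, hpU⟩ := eventually_nhds_iff.1 hall
    exact ⟨U, hUo, hpU, fun q hq hqF τ _ => hU q hq τ fun σ => hqF σ.1 (hBF σ.2)⟩
  · rintro hp ⟨U, hUo, hpU, hU⟩
    have hall : ∀ᶠ q in nhds p, ∀ τ : Finset (Fin n), τ ∈ F →
        (∀ σ : B, vol d σ.1 q = vol d σ.1 p) → vol d τ q = vol d τ p := by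
      rw [Filter.eventually_all]
      intro τ
      by_cases hτ : τ ∈ F
      swap
      · exact Filter.Eventually.of_forall fun q h => absurd h hτ
      refine (fun_dep (fun σ : B => vol d σ.1) (fun σ => vol_cd1 _) (vol d τ) (vol_cd1 _) p
        hli ?_).mono fun q h _ => h
      filter_upwards [hev] with q hq
      by_contra hcon
      have hcon' : fderiv ℝ (vol d τ) q ∉
          Submodule.span ℝ ((fun σ => fderiv ℝ (vol d σ) q) '' B) := by
        rwa [Set.image_eq_range]
      have h1 := li_generic p hp _ q (hq.insert hcon')
      have hτB : τ ∉ B := fun h => hcon (Submodule.subset_span ⟨⟨τ, h⟩, rfl⟩)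
      have h2 := h1.notMem_span_of_insert hτB
      apply h2
      rw [Set.image_eq_range]
      have h3 : fderiv ℝ (vol d τ) p ∈
          Submodule.span ℝ (Set.range fun σ : F => fderiv ℝ (vol d σ.1) p) :=
        Submodule.subset_span ⟨⟨τ, hτ⟩, rfl⟩
      rw [← hsp'] at h3
      exact h3
    have hmem : ∀ τ : Finset (Fin n), fderiv ℝ (vol d τ) p ∈
        Submodule.span ℝ (Set.range fun σ : B => fderiv ℝ (vol d σ.1) p) := by
      intro τ
      refine mem_span_of_const (fun σ : B => vol d σ.1) (fun σ => vol_cd1 _) (vol d τ)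
        (vol_cd1 _) p hli ?_
      filter_upwards [hall, hUo.mem_nhds hpU] with q hq hqU hB
      by_cases hτ : τ.card = d + 1
      · exact hU q hqU (fun σ hσ => hq σ hσ hB) τ hτ
      · simp [vol, hτ]
    have heq : Submodule.span ℝ (Set.range fun σ : B => fderiv ℝ (vol d σ.1) p) = spanAll d p := by
      refine le_antisymm (finrank_le_spanAll p B) ?_
      rw [spanAll, Submodule.span_le]
      rintro _ ⟨τ, rfl⟩
      exact hmem τ
    rw [← hsp', heq]
    exact span_generic hd hn p hp
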